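/- arXiv:1304.7332 — 3 statements merged into one kernel-verified Lean document; each statement's English description precedes it below -/
import Mathlib

section
/- Let u: A → B be a flat morphism of noetherian rings and k a natural number. If A has property (C_k) and all fibers of u satisfy Serre's condition (S_k), then B has property (C_k). -/
open IsLocalRing

/-- The `I`-depth (grade) of an `A`-module `M`: the supremum of lengths of
`M`-regular sequences with entries in `I`. -/
noncomputable def idealDepth {A : Type*} [CommRing A] (I : Ideal A)
    (M : Type*) [AddCommGroup M] [Module A M] : ℕ∞ :=
  sSup {n : ℕ∞ | ∃ rs : List A, (rs.length : ℕ∞) = n ∧ (∀ r ∈ rs, r ∈ I) ∧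
    RingTheory.Sequence.IsRegular M rs}

/-- The depth of a local ring: the depth with respect to its maximal ideal. -/
noncomputable def ringDepth (A : Type*) [CommRing A] [IsLocalRing A] : ℕ∞ :=
  idealDepth (IsLocalRing.maximalIdeal A) A

/-- depth(A_P), the depth of the localization of `A` at the prime `P`. -/
noncomputable def localDepth {A : Type*} [CommRing A] (P : Ideal A) [P.IsPrime] : ℕ∞ :=
  ringDepth (Localization.AtPrime P)

/-- The height of a prime ideal. -/
noncomputable def primeHeight {A : Type*} [CommRing A] (P : Ideal A) [P.IsPrime] : ℕ∞ :=
  Order.height (⟨P, inferInstance⟩ : PrimeSpectrum A)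

/-- A noetherian local ring is almost Cohen-Macaulay if `dim A ≤ 1 + depth A`. -/
def IsAlmostCM (A : Type*) [CommRing A] [IsLocalRing A] : Prop :=
  ringKrullDim A ≤ ((1 + ringDepth A : ℕ∞) : WithBot ℕ∞)

/-- Almost Cohen-Macaulay for a (local) ring presented with an explicit maximal ideal `I`:
`dim R ≤ 1 + depth_I R`. -/
def IsAlmostCMWith (R : Type*) [CommRing R] (I : Ideal R) : Prop :=
  ringKrullDim R ≤ ((1 + idealDepth I R : ℕ∞) : WithBot ℕ∞)

/-- A ring is almost Cohen-Macaulay (Han/Kang) if `depth_P A = depth (A_P)` for all primes. -/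
def IsACM (A : Type*) [CommRing A] : Prop :=
  ∀ (P : Ideal A) [P.IsPrime], idealDepth P A = localDepth P

/-- Serre's condition `(S_k)`: `depth A_P ≥ min (ht P, k)` for all primes `P`. -/
def SerreCond (k : ℕ) (A : Type*) [CommRing A] : Prop :=
  ∀ (P : Ideal A) [P.IsPrime], min (primeHeight P) (k : ℕ∞) ≤ localDepth P

/-- The condition `(C_k)`: `depth A_P ≥ min (ht P, k) - 1` for all primes `P`. -/
def CondC (k : ℕ) (A : Type*) [CommRing A] : Prop :=
  ∀ (P : Ideal A) [P.IsPrime], min (primeHeight P) (k : ℕ∞) ≤ 1 + localDepth P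

open scoped TensorProduct Pointwise

namespace LinearMap

variable {R M : Type*} [CommRing R] [AddCommGroup M] [Module R M] (φ : M →ₗ[R] M)

lemma lTensor_injective_of_field {K N : Type*} [Field K] [Algebra R K] [AddCommGroup N]
    [Module R N] [Module K N] [IsScalarTower R K N]
    (h : Function.Injective (φ.lTensor K)) : Function.Injective (φ.lTensor N) := by
  let e := TensorProduct.AlgebraTensorModule.cancelBaseChange R K K N M
  have h' : Function.Injective ((φ.baseChange K).lTensor N) :=
    Module.Flat.lTensor_preserves_injective_linearMap _ h
  have key : ∀ x, φ.lTensor N (e x) = e ((φ.baseChange K).lTensor N x) := by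
    intro x
    induction x with
    | zero => simp
    | add x y hx hy => simp [hx, hy]
    | tmul n y =>
      induction y with
      | zero => simp
      | add x y hx hy => simp [TensorProduct.tmul_add, hx, hy]
      | tmul k m => simp [e]
  intro x y hxy
  obtain ⟨x, rfl⟩ := e.surjective x
  obtain ⟨y, rfl⟩ := e.surjective y
  rw [key, key] at hxy
  rw [h' (e.injective hxy)]

lemma lTensor_injective_of_submodule [Module.Flat R M] {N : Type*} [AddCommGroup N] [Module R N]
    (N' : Submodule R N) (h₁ : Function.Injective (φ.lTensor N'))
    (h₂ : Function.Injective (φ.lTensor (N ⧸ N'))) : Function.Injective (φ.lTensor N) := by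
  rw [injective_iff_map_eq_zero] at h₁ h₂ ⊢
  intro x hx
  have hq : N'.mkQ.rTensor M x = 0 := by
    apply h₂
    rw [← comp_apply, lTensor_comp_rTensor, ← rTensor_comp_lTensor, comp_apply, hx, map_zero]
  obtain ⟨y, rfl⟩ := (rTensor_exact M (exact_subtype_mkQ N') N'.mkQ_surjective x).mp hq
  rw [← comp_apply, lTensor_comp_rTensor, ← rTensor_comp_lTensor, comp_apply] at hx
  rw [h₁ y, map_zero]
  exact (injective_iff_map_eq_zero _).mp
    (Module.Flat.rTensor_preserves_injective_linearMap _ N'.injective_subtype) _ hx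

lemma lTensor_injective_of_pow_smul_eq_bot [Module.Flat R M] (𝔪 : Ideal R) [𝔪.IsMaximal]
    (h : Function.Injective (φ.lTensor (R ⧸ 𝔪))) (n : ℕ) {N : Type*} [AddCommGroup N] [Module R N]
    (hN : (𝔪 ^ n • ⊤ : Submodule R N) = ⊥) : Function.Injective (φ.lTensor N) := by
  induction n generalizing N with
  | zero =>
    have : Subsingleton N := by
      rw [pow_zero, Ideal.one_eq_top, Submodule.top_smul] at hN
      exact (Submodule.subsingleton_iff R).mp (subsingleton_of_bot_eq_top hN.symm)
    exact Function.injective_of_subsingleton _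
  | succ n ih =>
    refine lTensor_injective_of_submodule φ (𝔪 • ⊤) (ih ?_) ?_
    · apply Submodule.map_injective_of_injective (Submodule.injective_subtype _)
      rw [Submodule.map_smul'', Submodule.map_top, Submodule.range_subtype, Submodule.map_bot,
        ← mul_smul, ← pow_succ, hN]
    · let := Ideal.Quotient.field 𝔪
      exact lTensor_injective_of_field (K := R ⧸ 𝔪) φ h

lemma lTensor_quotient_injective_iff (I : Ideal R) :
    Function.Injective (φ.lTensor (R ⧸ I)) ↔
      ∀ x, φ x ∈ (I • ⊤ : Submodule R M) → x ∈ (I • ⊤ : Submodule R M) := by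
  let e := TensorProduct.quotTensorEquivQuotSMul M I
  have key : ∀ x : M, φ.lTensor (R ⧸ I) (e.symm (Submodule.Quotient.mk x)) =
      e.symm (Submodule.Quotient.mk (φ x)) := by
    intro x
    simp [e]
  rw [injective_iff_map_eq_zero]
  constructor
  · intro h x hx
    rw [← Submodule.Quotient.mk_eq_zero] at hx ⊢
    apply e.symm.injective
    rw [map_zero]
    apply h
    rw [key, hx, map_zero]
  · intro h y hy
    obtain ⟨x, rfl⟩ := e.symm.surjective y
    obtain ⟨x, rfl⟩ := Submodule.Quotient.mk_surjective _ x
    rw [key, LinearEquiv.map_eq_zero_iff, Submodule.Quotient.mk_eq_zero] at hy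
    rw [(Submodule.Quotient.mk_eq_zero _).mpr (h x hy), map_zero]

end LinearMap

lemma Module.Flat.of_exact_of_forall_mem_smul_top {R M Q : Type*} [CommRing R] [AddCommGroup M]
    [Module R M] [AddCommGroup Q] [Module R Q] [Module.Flat R M] (φ : M →ₗ[R] M) (π : M →ₗ[R] Q)
    (hπ : Function.Surjective π) (hex : Function.Exact φ π)
    (h : ∀ (I : Ideal R) (x : M), φ x ∈ (I • ⊤ : Submodule R M) → x ∈ (I • ⊤ : Submodule R M)) :
    Module.Flat R Q := by
  rw [Module.Flat.iff_rTensor_injective']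
  intro I
  rw [injective_iff_map_eq_zero]
  intro z hz
  obtain ⟨z, rfl⟩ := LinearMap.lTensor_surjective I hπ z
  let μ : I ⊗[R] M →ₗ[R] M := (TensorProduct.lid R M).toLinearMap ∘ₗ I.subtype.rTensor M
  have hμ : Function.Injective μ := (TensorProduct.lid R M).injective.comp
    (Module.Flat.rTensor_preserves_injective_linearMap _ I.injective_subtype)
  have hrange : LinearMap.range μ = I • ⊤ := by
    apply le_antisymm
    · rintro _ ⟨w, rfl⟩
      induction w with
      | zero => simp
      | add x y hx hy => rw [map_add]; exact add_mem hx hy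
      | tmul i m => exact Submodule.smul_mem_smul i.2 trivial
    · rw [Submodule.smul_le]
      exact fun i hi m _ ↦ ⟨⟨i, hi⟩ ⊗ₜ m, by simp [μ]⟩
  have hπμ : π (μ z) = 0 := by
    have := congrArg (TensorProduct.lid R Q) hz
    rw [map_zero, ← LinearMap.comp_apply (LinearMap.rTensor _ _),
      LinearMap.rTensor_comp_lTensor, ← LinearMap.lTensor_comp_rTensor] at this
    rw [← this]
    simp only [μ, LinearMap.comp_apply, LinearEquiv.coe_coe]
    generalize (I.subtype.rTensor M) z = w
    induction w with
    | zero => simp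
    | add x y hx hy => simp [hx, hy]
    | tmul i m => simp
  obtain ⟨x, hx⟩ := (hex _).mp hπμ
  have hxI : x ∈ (I • ⊤ : Submodule R M) := h I x (by rw [hx, ← hrange]; exact ⟨z, rfl⟩)
  rw [← hrange] at hxI
  obtain ⟨w, rfl⟩ := hxI
  have hcomm : φ (μ w) = μ (φ.lTensor I w) := by
    clear hx
    induction w with
    | zero => simp
    | add x y hx hy => simp [hx, hy]
    | tmul i m => simp [μ]
  rw [hcomm] at hx
  rw [← hμ hx, ← LinearMap.comp_apply, ← LinearMap.lTensor_comp, hex.linearMap_comp_eq_zero,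
    LinearMap.lTensor_zero, LinearMap.zero_apply]

lemma Ideal.restrictScalars_map_smul_top {R S M : Type*} [CommRing R] [CommRing S] [Algebra R S]
    [AddCommGroup M] [Module R M] [Module S M] [IsScalarTower R S M] (I : Ideal R) :
    (I.map (algebraMap R S) • ⊤ : Submodule S M).restrictScalars R = I • ⊤ :=
  Ideal.smul_restrictScalars I ⊤

/-- Reducing modulo an element and modulo an ideal commute. -/
noncomputable def QuotSMulTop.quotientSMulTopEquiv {S : Type*} [CommRing S] (M : Type*)
    [AddCommGroup M] [Module S M] (b : S) (J : Ideal S) :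
    QuotSMulTop b (M ⧸ (J • ⊤ : Submodule S M)) ≃ₗ[S]
      QuotSMulTop b M ⧸ (J • ⊤ : Submodule S (QuotSMulTop b M)) :=
  Submodule.quotEquivOfEq _ _ (by
      rw [Submodule.map_pointwise_smul, Submodule.map_top, Submodule.range_mkQ]) ≪≫ₗ
    Submodule.quotientQuotientEquivQuotientSup (J • ⊤ : Submodule S M) (b • ⊤) ≪≫ₗ
    Submodule.quotEquivOfEq _ _ (sup_comm _ _) ≪≫ₗ
    (Submodule.quotientQuotientEquivQuotientSup (b • ⊤ : Submodule S M) (J • ⊤)).symm ≪≫ₗ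
    Submodule.quotEquivOfEq _ _ (by
      rw [Submodule.map_smul'', Submodule.map_top, Submodule.range_mkQ])

lemma IsLocalRing.mem_smul_top_of_forall_mem_sup_pow_smul_top {R : Type*} (S : Type*)
    {M : Type*} [CommRing R] [CommRing S] [IsLocalRing R] [IsLocalRing S] [IsNoetherianRing S]
    [Algebra R S] [IsLocalHom (algebraMap R S)] [AddCommGroup M] [Module R M] [Module S M]
    [IsScalarTower R S M] [Module.Finite S M] (I : Ideal R) {x : M}
    (hx : ∀ n, x ∈ ((I ⊔ maximalIdeal R ^ n) • ⊤ : Submodule R M)) :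
    x ∈ (I • ⊤ : Submodule R M) := by
  rw [← Ideal.restrictScalars_map_smul_top (S := S), Submodule.restrictScalars_mem]
  set N : Submodule S M := I.map (algebraMap R S) • ⊤
  rw [← Submodule.Quotient.mk_eq_zero, ← Submodule.mem_bot S,
    ← Ideal.iInf_pow_smul_eq_bot_of_isLocalRing _ (Ideal.IsPrime.ne_top' (I := maximalIdeal S)),
    Submodule.mem_iInf]
  intro n
  have h := hx n
  rw [← Ideal.restrictScalars_map_smul_top (S := S), Submodule.restrictScalars_mem, Ideal.map_sup,
    Submodule.sup_smul, Ideal.map_pow] at h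
  have h' := Submodule.mem_map_of_mem (f := N.mkQ) h
  rw [Submodule.map_sup, Submodule.mkQ_map_self, bot_sup_eq, Submodule.map_smul'',
    Submodule.map_top, Submodule.range_mkQ] at h'
  exact Submodule.smul_mono_left
    (Ideal.pow_right_mono
      (((local_hom_TFAE (algebraMap R S)).out 0 2 rfl rfl).mp inferInstance) n) h'

section

variable {R S : Type*} [CommRing R] [CommRing S] [IsLocalRing R] [IsLocalRing S]
  [IsNoetherianRing S] [Algebra R S] [IsLocalHom (algebraMap R S)]
  {M : Type*} [AddCommGroup M] [Module R M] [Module S M] [IsScalarTower R S M] [Module.Finite S M]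
  [Module.Flat R M]

lemma mem_smul_top_of_isSMulRegular_quotient_maximalIdeal {b : S}
    (hb : IsSMulRegular (M ⧸ ((maximalIdeal R).map (algebraMap R S) • ⊤ : Submodule S M)) b)
    (I : Ideal R) {x : M} (hx : b • x ∈ (I • ⊤ : Submodule R M)) :
    x ∈ (I • ⊤ : Submodule R M) := by
  have h : Function.Injective ((Module.toModuleEnd R M b).lTensor (R ⧸ maximalIdeal R)) := by
    rw [LinearMap.lTensor_quotient_injective_iff]
    intro y hy
    rw [← Ideal.restrictScalars_map_smul_top (S := S), Submodule.restrictScalars_mem] at hy ⊢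
    exact mem_of_isSMulRegular_quotient_of_smul_mem hb hy
  refine IsLocalRing.mem_smul_top_of_forall_mem_sup_pow_smul_top S I fun n ↦ ?_
  refine (LinearMap.lTensor_quotient_injective_iff (Module.toModuleEnd R M b) _).mp
    (LinearMap.lTensor_injective_of_pow_smul_eq_bot _ (maximalIdeal R) h n ?_) x
    (Submodule.smul_mono_left le_sup_left hx)
  rw [eq_bot_iff, Submodule.smul_le]
  rintro r hr y -
  obtain ⟨y, rfl⟩ := Ideal.Quotient.mk_surjective y
  exact Ideal.Quotient.eq_zero_iff_mem.mpr (Ideal.mul_mem_right _ _ (le_sup_right (a := I) hr))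

lemma IsSMulRegular.of_flat_of_quotient_maximalIdeal {b : S}
    (hb : IsSMulRegular (M ⧸ ((maximalIdeal R).map (algebraMap R S) • ⊤ : Submodule S M)) b) :
    IsSMulRegular M b :=
  .of_right_eq_zero_of_smul fun x hx ↦ by
    simpa using mem_smul_top_of_isSMulRegular_quotient_maximalIdeal hb ⊥ (x := x) (by simp [hx])

lemma Module.Flat.quotSMulTop_of_isSMulRegular_quotient_maximalIdeal {b : S}
    (hb : IsSMulRegular (M ⧸ ((maximalIdeal R).map (algebraMap R S) • ⊤ : Submodule S M)) b) :
    Module.Flat R (QuotSMulTop b M) := by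
  let π : M →ₗ[R] QuotSMulTop b M := (Submodule.mkQ (b • ⊤ : Submodule S M)).restrictScalars R
  have hπ : Function.Surjective π := Submodule.mkQ_surjective (b • ⊤ : Submodule S M)
  refine .of_exact_of_forall_mem_smul_top (Module.toModuleEnd R M b) π hπ (fun x ↦ ?_)
    fun I x hx ↦ mem_smul_top_of_isSMulRegular_quotient_maximalIdeal hb I hx
  simp only [π, LinearMap.coe_restrictScalars, Submodule.mkQ_apply, Submodule.Quotient.mk_eq_zero,
    Submodule.mem_smul_pointwise_iff_exists, Submodule.mem_top, true_and, Set.mem_range,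
    Module.toModuleEnd_apply, DistribSMul.toLinearMap_apply]

open RingTheory.Sequence

/-- The slicing criterion for flatness, for sequences. -/
theorem isWeaklyRegular_and_flat_of_isWeaklyRegular_quotient_maximalIdeal {ys : List S}
    (h : IsWeaklyRegular (M ⧸ ((maximalIdeal R).map (algebraMap R S) • ⊤ : Submodule S M)) ys) :
    IsWeaklyRegular M ys ∧ Module.Flat R (M ⧸ (Ideal.ofList ys • ⊤ : Submodule S M)) := by
  induction ys generalizing M with
  | nil =>
    refine ⟨.nil _ _, .of_linearEquiv ((Submodule.quotEquivOfEqBot _ ?_).restrictScalars R)⟩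
    simp
  | cons b ys ih =>
    rw [isWeaklyRegular_cons_iff] at h
    have := Module.Flat.quotSMulTop_of_isSMulRegular_quotient_maximalIdeal h.1
    obtain ⟨h₁, h₂⟩ := ih
      (((QuotSMulTop.quotientSMulTopEquiv M b _).isWeaklyRegular_congr ys).mp h.2)
    exact ⟨.cons (.of_flat_of_quotient_maximalIdeal h.1) h₁,
      .of_linearEquiv
        ((Submodule.quotOfListConsSMulTopEquivQuotSMulTopInner M b ys).restrictScalars R)⟩

/-- In a flat local extension, a regular sequence of the closed fiber followed by a regular
sequence of the base is regular. -/
theorem isRegular_append_map_of_flat [Module.Flat R S] {xs : List R} {ys : List S}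
    (hxs : IsWeaklyRegular R xs) (hxs' : ∀ x ∈ xs, x ∈ maximalIdeal R)
    (hys : IsWeaklyRegular
      (S ⧸ ((maximalIdeal R).map (algebraMap R S) • ⊤ : Submodule S S)) ys)
    (hys' : ∀ y ∈ ys, y ∈ maximalIdeal S) :
    IsRegular S (ys ++ xs.map (algebraMap R S)) := by
  rw [isRegular_iff_isWeaklyRegular_of_subset_maximalIdeal, isWeaklyRegular_append_iff,
    isWeaklyRegular_map_algebraMap_iff]
  · obtain ⟨h₁, h₂⟩ := isWeaklyRegular_and_flat_of_isWeaklyRegular_quotient_maximalIdeal hys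
    let e := TensorProduct.rid R (S ⧸ (Ideal.ofList ys • ⊤ : Submodule S S))
    exact ⟨h₁, (e.isWeaklyRegular_congr xs).mp hxs.isWeaklyRegular_lTensor⟩
  · intro r hr
    rcases List.mem_append.mp hr with hr | hr
    · exact hys' r hr
    · obtain ⟨x, hx, rfl⟩ := List.mem_map.mp hr
      exact ((local_hom_TFAE (algebraMap R S)).out 0 2 rfl rfl).mp inferInstance
        (Ideal.mem_map_of_mem _ (hxs' x hx))

end

section

variable {R S F : Type*} [CommRing R] [CommRing S] [CommRing F] [IsLocalRing R] [IsLocalRing S]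
  [IsLocalRing F] [IsNoetherianRing S] [Algebra R S]
  [IsLocalHom (algebraMap R S)]

open RingTheory.Sequence

lemma ringDepth_eq_iSup (T : Type*) [CommRing T] [IsLocalRing T] :
    ringDepth T = ⨆ rs : {rs : List T // (∀ r ∈ rs, r ∈ maximalIdeal T) ∧ IsRegular T rs},
      (rs.1.length : ℕ∞) := by
  rw [ringDepth, idealDepth, iSup]
  congr 1
  ext n
  simp only [Set.mem_ofPred_eq, Set.mem_range, Subtype.exists, exists_prop]
  exact exists_congr fun _ ↦ and_comm

instance (T : Type*) [CommRing T] [IsLocalRing T] :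
    Nonempty {rs : List T // (∀ r ∈ rs, r ∈ maximalIdeal T) ∧ IsRegular T rs} :=
  ⟨[], by simp, .nil _ _⟩

lemma ringDepth_add_ringDepth_le_of_flat [Module.Flat R S]
    (e : F ≃+* S ⧸ (maximalIdeal R).map (algebraMap R S)) :
    ringDepth F + ringDepth R ≤ ringDepth S := by
  simp only [ringDepth_eq_iSup]
  refine ENat.iSup_add_iSup_le ?_
  rintro ⟨zs, hzs, hzs'⟩ ⟨xs, hxs, hxs'⟩
  choose l hl using fun z ↦ Ideal.Quotient.mk_surjective (e z)
  have hl' : ∀ y ∈ zs.map l, y ∈ maximalIdeal S := by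
    simp only [List.forall_mem_map]
    intro z hz h
    exact hzs z hz ((MulEquiv.isUnit_map e).mp (hl z ▸ h.map (Ideal.Quotient.mk _)))
  have hreg : IsWeaklyRegular (S ⧸ ((maximalIdeal R).map (algebraMap R S) • ⊤ : Submodule S S))
      (zs.map l) := by
    rw [show ((maximalIdeal R).map (algebraMap R S) • ⊤ : Submodule S S) =
      (maximalIdeal R).map (algebraMap R S) from Ideal.mul_top _]
    refine (e.toAddEquiv.isWeaklyRegular_congr ?_).mp hzs'.toIsWeaklyRegular
    simp only [List.forall₂_map_right_iff, List.forall₂_same]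
    intro z _ x
    simp [Algebra.smul_def, hl]
  refine le_iSup_of_le ⟨zs.map l ++ xs.map (algebraMap R S), fun y hy ↦ ?_,
    isRegular_append_map_of_flat hxs'.toIsWeaklyRegular hxs hreg hl'⟩ (by simp)
  rcases List.mem_append.mp hy with hy | hy
  · exact hl' y hy
  · obtain ⟨x, hx, rfl⟩ := List.mem_map.mp hy
    exact ((local_hom_TFAE (algebraMap R S)).out 0 2 rfl rfl).mp inferInstance
      (Ideal.mem_map_of_mem _ (hxs x hx))

lemma height_maximalIdeal_le_add [IsNoetherianRing R]
    (e : F ≃+* S ⧸ (maximalIdeal R).map (algebraMap R S)) :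
    (maximalIdeal S).height ≤ (maximalIdeal R).height + (maximalIdeal F).height := by
  refine (Ideal.height_le_height_add_of_liesOver (maximalIdeal R) (maximalIdeal S)).trans ?_
  rw [← e.symm.height_comap]
  gcongr
  have : Nontrivial (S ⧸ (maximalIdeal R).map (algebraMap R S)) := e.symm.toEquiv.nontrivial
  have : IsLocalHom (Ideal.Quotient.mk ((maximalIdeal R).map (algebraMap R S))) :=
    .of_surjective _ Ideal.Quotient.mk_surjective
  rw [Ideal.map_le_iff_le_comap]
  exact fun x hx h ↦ hx (((MulEquiv.isUnit_map e.symm).mp h).of_map)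

end

lemma primeHeight_eq_height_maximalIdeal {A : Type*} [CommRing A] (P : Ideal A) [P.IsPrime] :
    primeHeight P = (maximalIdeal (Localization.AtPrime P)).height := by
  have h := (maximalIdeal_height_eq_ringKrullDim (R := Localization.AtPrime P)).trans
    (IsLocalization.AtPrime.ringKrullDim_eq_height P (Localization.AtPrime P))
  rw [WithBot.coe_injective h]
  exact (PrimeSpectrum.height_eq_orderHeight ⟨P, _⟩).symm

open Algebra.TensorProduct in
/-- The local ring of a fiber is the closed fiber of the map of local rings. -/
noncomputable def Ideal.Fiber.localizationRingEquivQuotient {A B : Type*} [CommRing A]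
    [CommRing B] [Algebra A B] (P : Ideal A) [P.IsPrime]
    (q : Ideal (P.Fiber B)) [q.IsPrime]
    [Algebra (Localization.AtPrime P) (Localization.AtPrime (q.comap includeRight))]
    [Localization.AtPrime.IsLiesOverAlgebra P (q.comap includeRight)] :
    Localization.AtPrime q ≃+* Localization.AtPrime (q.comap includeRight) ⧸
      (maximalIdeal (Localization.AtPrime P)).map
        (algebraMap _ (Localization.AtPrime (q.comap includeRight))) :=
  (localizationAlgEquivQuotient P q).toRingEquiv.trans <| Ideal.quotEquivOfEq <| by
    rw [← Localization.AtPrime.map_eq_maximalIdeal, Ideal.map_map,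
      ← IsScalarTower.algebraMap_eq]

theorem condC_ascends_flat_serre_fibers {A B : Type*} [CommRing A] [CommRing B]
    [IsNoetherianRing A] [IsNoetherianRing B] [Algebra A B] [Module.Flat A B]
    (k : ℕ) (hA : CondC k A)
    (hfib : ∀ (P : Ideal A) [P.IsPrime],
      SerreCond k (TensorProduct A (ResidueField (Localization.AtPrime P)) B)) :
    CondC k B := by
  intro Q hQ
  obtain ⟨P, hP⟩ : ∃ P, P = Q.under A := ⟨_, rfl⟩
  have : P.IsPrime := hP ▸ inferInstance
  obtain ⟨⟨q, hq⟩, h⟩ := (PrimeSpectrum.primesOverOrderIsoFiber A B P).symm.surjective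
    ⟨Q, hQ, ⟨hP⟩⟩
  obtain rfl : Q = q.comap Algebra.TensorProduct.includeRight := (congrArg Subtype.val h).symm
  let r := q.comap Algebra.TensorProduct.includeRight
  have : r.LiesOver P := ⟨hP⟩
  let := Localization.AtPrime.algebraOfLiesOver P r
  let e := Ideal.Fiber.localizationRingEquivQuotient P q
  have : Module.Flat A (Localization.AtPrime r) := .trans A B _
  have : Module.Flat (Localization.AtPrime P) (Localization.AtPrime r) :=
    (Module.flat_iff_of_isLocalization (Localization.AtPrime P) P.primeCompl _).mpr this
  have hheight := height_maximalIdeal_le_add (R := Localization.AtPrime P)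
    (S := Localization.AtPrime r) (F := Localization.AtPrime q) e
  have hdepth := ringDepth_add_ringDepth_le_of_flat (R := Localization.AtPrime P)
    (S := Localization.AtPrime r) (F := Localization.AtPrime q) e
  simp only [← primeHeight_eq_height_maximalIdeal] at hheight
  calc min (primeHeight r) (k : ℕ∞)
      ≤ min (primeHeight P + primeHeight q) k := min_le_min_right _ hheight
    _ ≤ min (primeHeight P) k + min (primeHeight q) k := by
      rcases le_total (primeHeight P) k with hP | hP
      · rcases le_total (primeHeight q) k with hq | hq
        · simp [hP, hq]
        · simp [hq]
      · simp [hP]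
    _ ≤ (1 + localDepth P) + localDepth q := add_le_add (hA P) (hfib P q)
    _ = 1 + (localDepth q + localDepth P) := by rw [add_assoc, add_comm (localDepth P)]
    _ ≤ 1 + localDepth r := by gcongr; exact hdepth
end

section
/- Let u: A → B be a flat morphism of noetherian rings and k a natural number. If A satisfies Serre's condition (S_k) and all fibers of u have property (C_k), then B has property (C_k). -/
open IsLocalRing

section SlicingCriterion

open TensorProduct Pointwise

variable {A B N : Type*} [CommRing A] [CommRing B] [Algebra A B]
  [AddCommGroup N] [Module A N] [Module B N] [IsScalarTower A B N]

/-- If `N` is flat over `A`, then regularity of `y` on `N ⊗ M` can be checked on a submodule of `M`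
and the corresponding quotient. -/
lemma isSMulRegular_tensor_of_submodule_of_quotient [Module.Flat A N] {y : B}
    {M : Type*} [AddCommGroup M] [Module A M] (M' : Submodule A M)
    (h₁ : IsSMulRegular (N ⊗[A] M') y) (h₂ : IsSMulRegular (N ⊗[A] (M ⧸ M')) y) :
    IsSMulRegular (N ⊗[A] M) y := by
  refine isSMulRegular_of_range_eq_ker
    (f := AlgebraTensorModule.lTensor B N M'.subtype)
    (g := AlgebraTensorModule.lTensor B N M'.mkQ) ?_ ?_ h₁ h₂
  · exact Module.Flat.lTensor_preserves_injective_linearMap _ M'.injective_subtype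
  · have := (lTensor_exact N (LinearMap.exact_subtype_mkQ M') M'.mkQ_surjective)
    ext z
    exact (this z).symm

lemma isSMulRegular_tensor_of_isFiniteLength [IsLocalRing A] [Module.Flat A N] {y : B}
    (hy : IsSMulRegular (N ⊗[A] (A ⧸ maximalIdeal A)) y)
    {M : Type*} [AddCommGroup M] [Module A M] (hM : IsFiniteLength A M) :
    IsSMulRegular (N ⊗[A] M) y := by
  induction hM with
  | of_subsingleton => exact fun _ _ _ => Subsingleton.elim _ _
  | @of_simple_quotient M _ _ M' hs _ ih =>
    refine isSMulRegular_tensor_of_submodule_of_quotient M' ih ?_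
    obtain ⟨I, hI, ⟨e⟩⟩ := isSimpleModule_iff_quot_maximal.mp hs
    obtain rfl := eq_maximalIdeal hI
    exact ((AlgebraTensorModule.congr (LinearEquiv.refl B N) e).isSMulRegular_congr y).mpr hy

lemma isFiniteLength_quotient_maximalIdeal_pow_smul_top [IsLocalRing A] [IsNoetherianRing A]
    (M : Type*) [AddCommGroup M] [Module A M] [Module.Finite A M] (n : ℕ) :
    IsFiniteLength A (M ⧸ (maximalIdeal A ^ n • ⊤ : Submodule A M)) := by
  rw [isFiniteLength_iff_isNoetherian_isArtinian]
  refine ⟨inferInstance, ?_⟩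
  have : IsArtinianRing (A ⧸ maximalIdeal A ^ n) := by
    rcases subsingleton_or_nontrivial (A ⧸ maximalIdeal A ^ n) with _ | _
    · infer_instance
    · have : IsLocalRing (A ⧸ maximalIdeal A ^ n) :=
        .of_surjective' (Ideal.Quotient.mk _) Ideal.Quotient.mk_surjective
      rw [isArtinianRing_iff_isNilpotent_maximalIdeal]
      refine ⟨n, ?_⟩
      have hcomap : (maximalIdeal (A ⧸ maximalIdeal A ^ n)).comap (Ideal.Quotient.mk _) =
          maximalIdeal A :=
        eq_maximalIdeal (Ideal.comap_isMaximal_of_surjective _ Ideal.Quotient.mk_surjective)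
      rw [← Ideal.map_comap_of_surjective (Ideal.Quotient.mk (maximalIdeal A ^ n))
          Ideal.Quotient.mk_surjective (maximalIdeal _), hcomap,
        ← Ideal.map_pow, Ideal.map_quotient_self, Ideal.zero_eq_bot]
  have : Module.Finite (A ⧸ maximalIdeal A ^ n) (M ⧸ (maximalIdeal A ^ n • ⊤ : Submodule A M)) :=
    .of_restrictScalars_finite A _ _
  have : IsArtinian (A ⧸ maximalIdeal A ^ n) (M ⧸ (maximalIdeal A ^ n • ⊤ : Submodule A M)) :=
    inferInstance
  exact (LinearMap.isArtinian_iff_of_bijective (σ := Ideal.Quotient.mk (maximalIdeal A ^ n))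
    (⟨⟨id, fun _ _ => rfl⟩, fun _ _ => rfl⟩) Function.bijective_id).mpr this

/-- If `y` is regular on the closed fibre of an `A`-flat module `N`, then it is regular on `N ⊗ M`
for every finite `A`-module `M`. -/
lemma isSMulRegular_tensor_of_isSMulRegular_fiber [IsLocalRing A] [IsNoetherianRing A]
    [IsLocalRing B] [IsNoetherianRing B] [IsLocalHom (algebraMap A B)]
    [Module.Finite B N] [Module.Flat A N] {y : B}
    (hy : IsSMulRegular (N ⊗[A] (A ⧸ maximalIdeal A)) y)
    (M : Type*) [AddCommGroup M] [Module A M] [Module.Finite A M] :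
    IsSMulRegular (N ⊗[A] M) y := by
  refine IsSMulRegular.of_right_eq_zero_of_smul fun z hz => ?_
  have : Module.Finite B (N ⊗[A] M) :=
    .equiv (AlgebraTensorModule.cancelBaseChange A B B N M)
  set I := (maximalIdeal A).map (algebraMap A B)
  have hI : I ≠ ⊤ := ((((local_hom_TFAE (algebraMap A B)).out 0 2 rfl rfl).mp
    inferInstance).trans_lt (inferInstance : (maximalIdeal B).IsMaximal).lt_top).ne
  rw [← Submodule.mem_bot B, ← Ideal.iInf_pow_smul_eq_bot_of_isLocalRing (M := N ⊗[A] M) I hI,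
    Submodule.mem_iInf]
  intro n
  let M' : Submodule A M := maximalIdeal A ^ n • ⊤
  have hreg := isSMulRegular_tensor_of_isFiniteLength hy
    (isFiniteLength_quotient_maximalIdeal_pow_smul_top M n)
  have h0 : AlgebraTensorModule.lTensor B N M'.mkQ z = 0 :=
    hreg.right_eq_zero_of_smul (by rw [← map_smul, hz, map_zero])
  obtain ⟨w, rfl⟩ := (lTensor_exact N (LinearMap.exact_subtype_mkQ M') M'.mkQ_surjective z).mp h0
  clear h0 hz
  induction w with
  | zero => simp
  | add a b ha hb => rw [map_add]; exact add_mem ha hb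
  | tmul n x =>
    obtain ⟨x, hx⟩ := x
    simp only [LinearMap.lTensor_tmul, Submodule.subtype_apply]
    refine Submodule.smul_induction_on hx (fun a ha x _ => ?_) fun x y h₁ h₂ => ?_
    · rw [tmul_smul, ← algebraMap_smul B a]
      refine Submodule.smul_mem_smul ?_ trivial
      rw [← Ideal.map_pow]
      exact Ideal.mem_map_of_mem _ ha
    · rw [tmul_add]; exact add_mem h₁ h₂

lemma rTensor_lsmul_apply (y : B) {P : Type*} [AddCommGroup P] [Module A P] (x : N ⊗[A] P) :
    ((LinearMap.lsmul B N y).restrictScalars A).rTensor P x = y • x := by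
  induction x with
  | zero => simp
  | add a b ha hb => rw [map_add, ha, hb, smul_add]
  | tmul n x => rfl

/-- If `y` is regular on `N ⊗ A/I` for all ideals `I`, and `N` is flat over `A`,
then `N / yN` is flat over `A`. -/
lemma flat_quotSMulTop [Module.Flat A N] {y : B}
    (hy : ∀ I : Ideal A, IsSMulRegular (N ⊗[A] (A ⧸ I)) y) :
    Module.Flat A (QuotSMulTop y N) := by
  let π : N →ₗ[A] QuotSMulTop y N := (y • (⊤ : Submodule B N)).mkQ.restrictScalars A
  have hπ : Function.Surjective π := (y • (⊤ : Submodule B N)).mkQ_surjective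
  have hex : Function.Exact ((LinearMap.lsmul B N y).restrictScalars A) π := by
    intro x
    simp [π, Submodule.mem_smul_pointwise_iff_exists]
  clear_value π
  rw [Module.Flat.iff_lTensor_injective']
  intro I
  rw [injective_iff_map_eq_zero]
  intro t ht
  obtain ⟨t, rfl⟩ := LinearMap.rTensor_surjective I hπ t
  have h1 : π.rTensor A (I.subtype.lTensor N t) = 0 := by
    rw [← ht, ← LinearMap.comp_apply, ← LinearMap.comp_apply, LinearMap.rTensor_comp_lTensor,
      LinearMap.lTensor_comp_rTensor]
  obtain ⟨w, hw⟩ := (rTensor_exact A hex hπ _).mp h1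
  rw [rTensor_lsmul_apply] at hw
  have hI := lTensor_exact N (LinearMap.exact_subtype_mkQ I) I.mkQ_surjective
  have h2 : AlgebraTensorModule.lTensor B N I.mkQ w = 0 := by
    refine (hy I).right_eq_zero_of_smul ?_
    rw [← map_smul, hw]
    exact (hI _).mpr ⟨t, rfl⟩
  obtain ⟨w, rfl⟩ := (hI w).mp h2
  have h3 : y • w = t := by
    refine Module.Flat.lTensor_preserves_injective_linearMap (M := N) _ I.injective_subtype ?_
    rw [← hw]
    exact map_smul (AlgebraTensorModule.lTensor B N I.subtype) y w
  rw [← h3]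
  exact (rTensor_exact I hex hπ _).mpr ⟨w, rTensor_lsmul_apply y w⟩

/-- Tensoring over `A` commutes with `QuotSMulTop y ·` for `y` in an `A`-algebra. -/
noncomputable def quotSMulTopTensorEquivOfAlgebra (y : B) (M : Type*) [AddCommGroup M]
    [Module A M] : QuotSMulTop y N ⊗[A] M ≃ₗ[B] QuotSMulTop y (N ⊗[A] M) :=
  (AlgebraTensorModule.cancelBaseChange A B B (QuotSMulTop y N) M).symm ≪≫ₗ
    QuotSMulTop.quotSMulTopTensorEquivQuotSMulTop y (B ⊗[A] M) N ≪≫ₗ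
    QuotSMulTop.congr y (AlgebraTensorModule.cancelBaseChange A B B N M)

open RingTheory.Sequence

lemma isWeaklyRegular_tensor_of_isWeaklyRegular_fiber [IsLocalRing A] [IsNoetherianRing A]
    [IsLocalRing B] [IsNoetherianRing B] [IsLocalHom (algebraMap A B)]
    [Module.Finite B N] [Module.Flat A N] {ys : List B}
    (hys : IsWeaklyRegular (N ⊗[A] (A ⧸ maximalIdeal A)) ys)
    (M : Type*) [AddCommGroup M] [Module A M] [Module.Finite A M] :
    IsWeaklyRegular (N ⊗[A] M) ys := by
  induction ys generalizing N with
  | nil => exact .nil _ _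
  | cons y ys ih =>
    rw [isWeaklyRegular_cons_iff] at hys ⊢
    have := flat_quotSMulTop (N := N) (y := y) fun I =>
      isSMulRegular_tensor_of_isSMulRegular_fiber hys.1 _
    refine ⟨isSMulRegular_tensor_of_isSMulRegular_fiber hys.1 M, ?_⟩
    rw [← (quotSMulTopTensorEquivOfAlgebra y M).isWeaklyRegular_congr]
    refine ih ?_
    rw [(quotSMulTopTensorEquivOfAlgebra y _).isWeaklyRegular_congr]
    exact hys.2

end SlicingCriterion

section Depth

open RingTheory.Sequence TensorProduct

lemma idealDepth_eq_biSup {A : Type*} [CommRing A] (I : Ideal A)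
    (M : Type*) [AddCommGroup M] [Module A M] :
    idealDepth I M =
      ⨆ rs ∈ {rs : List A | (∀ r ∈ rs, r ∈ I) ∧ IsRegular M rs}, (rs.length : ℕ∞) := by
  refine le_antisymm (sSup_le ?_) (iSup₂_le fun rs hrs => le_sSup ⟨rs, rfl, hrs⟩)
  rintro _ ⟨rs, rfl, hrs⟩
  exact le_iSup₂_of_le rs hrs le_rfl

lemma ringDepth_le_of_ringEquiv {R S : Type*} [CommRing R] [CommRing S] [IsLocalRing R]
    [IsLocalRing S] (e : R ≃+* S) : ringDepth R ≤ ringDepth S := by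
  refine sSup_le ?_
  rintro _ ⟨rs, rfl, hmem, hreg⟩
  refine le_sSup ⟨rs.map e, by simp, ?_, ?_⟩
  · simp only [List.mem_map, forall_exists_index, and_imp]
    rintro _ r hr rfl
    simpa using hmem r hr
  · refine (e.toAddEquiv.isRegular_congr <| List.forall₂_map_right_iff.mpr <|
      List.forall₂_same.mpr fun r _ x => ?_).mp hreg
    simp

/-- The inequality `depth A + depth (B / 𝔪_A B) ≤ depth B` for a flat local homomorphism of
noetherian local rings. -/
lemma ringDepth_add_ringDepth_quotient_le {A B : Type*} [CommRing A] [CommRing B]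
    [IsLocalRing A] [IsLocalRing B] [IsNoetherianRing A] [IsNoetherianRing B] [Algebra A B]
    [IsLocalHom (algebraMap A B)] [Module.Flat A B]
    [IsLocalRing (B ⧸ (maximalIdeal A).map (algebraMap A B))] :
    ringDepth A + ringDepth (B ⧸ (maximalIdeal A).map (algebraMap A B)) ≤ ringDepth B := by
  set I := (maximalIdeal A).map (algebraMap A B)
  unfold ringDepth
  rw [idealDepth_eq_biSup, idealDepth_eq_biSup]
  refine ENat.biSup_add_biSup_le (by exact ⟨[], by simp, .nil _ _⟩)
    (by exact ⟨[], by simp, .nil _ _⟩) ?_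
  rintro xs ⟨hxm, hxs⟩ ys ⟨hym, hys⟩
  obtain ⟨ys, rfl⟩ := List.map_surjective_iff.mpr (Ideal.Quotient.mk_surjective (I := I)) ys
  have hxm' : ∀ r ∈ xs.map (algebraMap A B), r ∈ maximalIdeal B := by
    simp only [List.mem_map, forall_exists_index, and_imp]
    rintro _ r hr rfl
    exact ((local_hom_TFAE (algebraMap A B)).out 0 2 rfl rfl).mp inferInstance
      (Ideal.mem_map_of_mem _ (hxm r hr))
  have hym' : ∀ r ∈ ys, r ∈ maximalIdeal B := fun r hr hu =>
    hym _ (List.mem_map_of_mem hr) (hu.map (Ideal.Quotient.mk I))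
  have hfib : IsWeaklyRegular (B ⊗[A] (A ⧸ maximalIdeal A)) ys := by
    have h := (isWeaklyRegular_map_algebraMap_iff (S := B ⧸ I) (B ⧸ I) ys).mp hys.1
    exact ((Algebra.TensorProduct.quotIdealMapEquivTensorQuot B
      (maximalIdeal A)).toLinearEquiv.isWeaklyRegular_congr ys).mp h
  have hquot := isWeaklyRegular_tensor_of_isWeaklyRegular_fiber hfib (A ⧸ Ideal.ofList xs)
  rw [← (Algebra.TensorProduct.quotIdealMapEquivTensorQuot B
      (Ideal.ofList xs)).toLinearEquiv.isWeaklyRegular_congr] at hquot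
  refine le_sSup ⟨xs.map (algebraMap A B) ++ ys, by simp [I], ?_, ?_⟩
  · intro r hr
    rcases List.mem_append.mp hr with h | h
    exacts [hxm' r h, hym' r h]
  · refine IsRegular.of_isWeaklyRegular_of_mem_maximalIdeal _ (fun r hr => ?_) ?_
    · rcases List.mem_append.mp hr with h | h
      exacts [hxm' r h, hym' r h]
    · rw [isWeaklyRegular_append_iff]
      refine ⟨hxs.1.of_flat, ?_⟩
      refine ((Submodule.quotEquivOfEq _ _ ?_).isWeaklyRegular_congr ys).mp hquot
      simp [Ideal.map_ofList]

end Depth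

lemma primeHeight_eq_height {R : Type*} [CommRing R] (P : Ideal R) [P.IsPrime] :
    primeHeight P = P.height :=
  ((⟨P, inferInstance⟩ : PrimeSpectrum R).height_eq_orderHeight).symm

lemma height_maximalIdeal_of_ringEquiv {R S : Type*} [CommRing R] [CommRing S] [IsLocalRing R]
    [IsLocalRing S] (e : R ≃+* S) : (maximalIdeal R).height = (maximalIdeal S).height := by
  have := ringKrullDim_eq_of_ringEquiv e
  rw [← maximalIdeal_height_eq_ringKrullDim, ← maximalIdeal_height_eq_ringKrullDim] at this
  exact_mod_cast this

lemma height_eq_height_maximalIdeal_localization {R : Type*} [CommRing R] (P : Ideal R)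
    [P.IsPrime] : P.height = (maximalIdeal (Localization.AtPrime P)).height := by
  have h := IsLocalization.AtPrime.ringKrullDim_eq_height P (Localization.AtPrime P)
  rw [← maximalIdeal_height_eq_ringKrullDim] at h
  exact_mod_cast h.symm

lemma height_maximalIdeal_le_add_quotient {A B : Type*} [CommRing A] [CommRing B]
    [IsLocalRing A] [IsLocalRing B] [IsNoetherianRing A] [IsNoetherianRing B] [Algebra A B]
    [IsLocalHom (algebraMap A B)]
    [IsLocalRing (B ⧸ (maximalIdeal A).map (algebraMap A B))] :
    (maximalIdeal B).height ≤ (maximalIdeal A).height +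
      (maximalIdeal (B ⧸ (maximalIdeal A).map (algebraMap A B))).height := by
  have : (maximalIdeal B).LiesOver (maximalIdeal A) :=
    ⟨(((local_hom_TFAE (algebraMap A B)).out 0 4 rfl rfl).mp inferInstance).symm⟩
  convert Ideal.height_le_height_add_of_liesOver (maximalIdeal A) (maximalIdeal B)
  have h : (maximalIdeal (B ⧸ (maximalIdeal A).map (algebraMap A B))).comap
      (Ideal.Quotient.mk _) = maximalIdeal B :=
    eq_maximalIdeal (Ideal.comap_isMaximal_of_surjective _ Ideal.Quotient.mk_surjective)
  rw [← h, Ideal.map_comap_of_surjective _ Ideal.Quotient.mk_surjective]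

open TensorProduct in
/-- For a prime `q` of the fibre over `P` and its contraction `r` to `B`, flatness gives
`ht r ≤ ht P + ht q` and `depth A_P + depth (fibre)_q ≤ depth B_r`. -/
lemma height_le_and_localDepth_le_of_prime_fiber {A B : Type*} [CommRing A] [CommRing B]
    [IsNoetherianRing A] [IsNoetherianRing B] [Algebra A B] [Module.Flat A B]
    (P : Ideal A) [P.IsPrime] (q : Ideal (P.Fiber B)) [q.IsPrime] :
    primeHeight (q.comap (Algebra.TensorProduct.includeRight : B →ₐ[A] P.Fiber B)) ≤
        primeHeight P + primeHeight q ∧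
      localDepth P + localDepth q ≤
        localDepth (q.comap (Algebra.TensorProduct.includeRight : B →ₐ[A] P.Fiber B)) := by
  let r := q.comap (Algebra.TensorProduct.includeRight : B →ₐ[A] P.Fiber B)
  have : r.LiesOver P := inferInstance
  let := Localization.AtPrime.algebraOfLiesOver P r
  let Ap := Localization.AtPrime P
  let Br := Localization.AtPrime r
  have hloc : IsLocalHom (algebraMap Ap Br) := by
    rw [Localization.AtPrime.IsLiesOverAlgebra.algebraMap_eq (p := P) (P := r)]
    infer_instance
  have hI : P.map (algebraMap A Br) = (maximalIdeal Ap).map (algebraMap Ap Br) := by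
    rw [← Localization.AtPrime.map_eq_maximalIdeal, Ideal.map_map,
      ← IsScalarTower.algebraMap_eq]
  let e : Localization.AtPrime q ≃+* Br ⧸ (maximalIdeal Ap).map (algebraMap Ap Br) :=
    (Ideal.Fiber.localizationAlgEquivQuotient P q).toRingEquiv.trans (Ideal.quotEquivOfEq hI)
  have : IsLocalRing (Br ⧸ (maximalIdeal Ap).map (algebraMap Ap Br)) := e.isLocalRing
  constructor
  · simp only [primeHeight_eq_height]
    rw [height_eq_height_maximalIdeal_localization P, height_eq_height_maximalIdeal_localization q,
      height_eq_height_maximalIdeal_localization (q.comap _),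
      height_maximalIdeal_of_ringEquiv (R := Localization.AtPrime q) e]
    exact height_maximalIdeal_le_add_quotient
  · exact (add_le_add_right (ringDepth_le_of_ringEquiv e) _).trans
      ringDepth_add_ringDepth_quotient_le

theorem condC_ascends_flat_condC_fibers {A B : Type*} [CommRing A] [CommRing B]
    [IsNoetherianRing A] [IsNoetherianRing B] [Algebra A B] [Module.Flat A B]
    (k : ℕ) (hA : SerreCond k A)
    (hfib : ∀ (P : Ideal A) [P.IsPrime],
      CondC k (TensorProduct A (ResidueField (Localization.AtPrime P)) B)) :
    CondC k B := by
  intro Q _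
  let P := Q.under A
  obtain ⟨q, hq⟩ := (PrimeSpectrum.primesOverOrderIsoFiber A B P).symm.surjective
    ⟨Q, inferInstance, inferInstance⟩
  have hqQ : q.asIdeal.comap Algebra.TensorProduct.includeRight = Q := by
    rw [← PrimeSpectrum.coe_primesOverOrderIsoFiber_symm_apply, hq]
  obtain ⟨h₁, h₂⟩ := height_le_and_localDepth_le_of_prime_fiber P q.asIdeal
  have hP := hA P
  have hF := hfib P q.asIdeal
  simp only [hqQ] at h₁ h₂
  calc min (primeHeight Q) (k : ℕ∞)
      ≤ min (primeHeight P) k + min (primeHeight q.asIdeal) k := by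
        refine (min_le_min_right _ h₁).trans ?_
        rcases le_total (primeHeight P) k with h | h
        · rcases le_total (primeHeight q.asIdeal) k with h' | h'
          · simp [h, h']
          · simp [h', le_add_left]
        · simp [h, le_add_right]
    _ ≤ localDepth P + (1 + localDepth q.asIdeal) := add_le_add hP hF
    _ = 1 + (localDepth P + localDepth q.asIdeal) := by ring
    _ ≤ 1 + localDepth Q := by gcongr
end

section
/- Let u: A → B be a faithfully flat morphism of noetherian rings with Cohen-Macaulay fibers. Then B is almost Cohen-Macaulay if and only if A is almost Cohen-Macaulay. -/
open IsLocalRing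

/-- A ring is almost Cohen-Macaulay if all its localizations at primes are. -/
def IsACMring (R : Type*) [CommRing R] : Prop :=
  ∀ (P : Ideal R) [P.IsPrime], IsAlmostCM (Localization.AtPrime P)

/-- A ring is Cohen-Macaulay if `dim R_P = depth R_P` for every prime `P`. -/
def IsCMring (R : Type*) [CommRing R] : Prop :=
  ∀ (P : Ideal R) [P.IsPrime],
    ringKrullDim (Localization.AtPrime P) = ((localDepth P : ℕ∞) : WithBot ℕ∞)

section Depth

open RingTheory.Sequence

variable {R : Type*} [CommRing R] {M N : Type*} [AddCommGroup M] [Module R M]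
  [AddCommGroup N] [Module R N]

lemma length_le_idealDepth {I : Ideal R} {rs : List R} (hI : ∀ r ∈ rs, r ∈ I)
    (h : IsRegular M rs) : (rs.length : ℕ∞) ≤ idealDepth I M :=
  le_sSup ⟨rs, rfl, hI, h⟩

lemma idealDepth_le_iff {I : Ideal R} {n : ℕ∞} : idealDepth I M ≤ n ↔
    ∀ rs : List R, (∀ r ∈ rs, r ∈ I) → IsRegular M rs → (rs.length : ℕ∞) ≤ n := by
  refine sSup_le_iff.trans ⟨fun h rs hI hr ↦ h _ ⟨rs, rfl, hI, hr⟩, ?_⟩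
  rintro h _ ⟨rs, rfl, hI, hr⟩
  exact h rs hI hr

lemma LinearEquiv.idealDepth_eq (e : M ≃ₗ[R] N) (I : Ideal R) :
    idealDepth I M = idealDepth I N := by
  simp only [idealDepth, e.isRegular_congr]

/-- The depth of `S` over itself agrees with its depth over a ring surjecting onto it. -/
lemma idealDepth_comap_of_surjective {S : Type*} [CommRing S] [Algebra R S]
    (hs : Function.Surjective (algebraMap R S)) (I : Ideal S) :
    idealDepth (I.comap (algebraMap R S)) S = idealDepth I S := by
  have key (rs : List R) : IsRegular S (rs.map (algebraMap R S)) ↔ IsRegular S rs :=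
    (AddEquiv.refl S).isRegular_congr <| List.forall₂_map_left_iff.mpr <|
      List.forall₂_same.mpr fun r _ x ↦ algebraMap_smul S r x
  apply le_antisymm
  · refine idealDepth_le_iff.mpr fun rs hI hr ↦ ?_
    rw [← List.length_map (algebraMap R S)]
    exact length_le_idealDepth (by simpa using hI) ((key rs).mpr hr)
  · refine idealDepth_le_iff.mpr fun rs hI hr ↦ ?_
    obtain ⟨rs, rfl⟩ := (List.map_surjective_iff.mpr hs) rs
    rw [List.length_map]
    exact length_le_idealDepth (by simpa using hI) ((key rs).mp hr)

lemma RingEquiv.ringDepth_eq {S : Type*} [CommRing S] [IsLocalRing R] [IsLocalRing S]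
    (e : R ≃+* S) : ringDepth R = ringDepth S := by
  let : Algebra R S := e.toRingHom.toAlgebra
  have hc : (maximalIdeal S).comap (algebraMap R S) = maximalIdeal R := by
    ext x
    simp [mem_maximalIdeal, RingHom.algebraMap_toAlgebra]
  rw [ringDepth, ringDepth, ← idealDepth_comap_of_surjective (R := R) e.surjective, hc]
  exact LinearEquiv.idealDepth_eq
    (LinearEquiv.ofBijective (Algebra.linearMap R S) e.bijective) _

/-- If `x` and `y` are `M`-regular and `I` kills a nonzero element of `M / xM`, then it kills a
nonzero element of `M / yM`, provided `y ∈ I`. -/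
lemma exists_ne_zero_smul_eq_zero_quotSMulTop {I : Ideal R} {x y : R} (hy : y ∈ I)
    (hxr : IsSMulRegular M x) (hyr : IsSMulRegular M y) {u : QuotSMulTop x M} (hu : u ≠ 0)
    (h : ∀ r ∈ I, r • u = 0) : ∃ v : QuotSMulTop y M, v ≠ 0 ∧ ∀ r ∈ I, r • v = 0 := by
  obtain ⟨m, rfl⟩ := Submodule.Quotient.mk_surjective _ u
  simp only [ne_eq, ← Submodule.Quotient.mk_smul, Submodule.Quotient.mk_eq_zero,
    Submodule.mem_smul_pointwise_iff_exists, Submodule.mem_top, true_and] at hu h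
  obtain ⟨m', hm'⟩ := h y hy
  refine ⟨Submodule.Quotient.mk m', ?_, fun r hr ↦ ?_⟩
  · simp only [ne_eq, Submodule.Quotient.mk_eq_zero,
      Submodule.mem_smul_pointwise_iff_exists, Submodule.mem_top, true_and]
    rintro ⟨m'', rfl⟩
    exact hu ⟨m'', hyr (by simpa [smul_comm y x] using hm')⟩
  · obtain ⟨p, hp⟩ := h r hr
    rw [← Submodule.Quotient.mk_smul, Submodule.Quotient.mk_eq_zero,
      Submodule.mem_smul_pointwise_iff_exists]
    refine ⟨p, trivial, hxr ?_⟩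
    simp only
    rw [smul_comm x r, hm', smul_comm r y, ← hp, smul_comm x y]

open scoped Pointwise in
/-- `M / xM / yM` and `M / yM / xM` are isomorphic. -/
noncomputable def quotSMulTopComm (M : Type*) [AddCommGroup M] [Module R M] (x y : R) :
    QuotSMulTop x (QuotSMulTop y M) ≃ₗ[R] QuotSMulTop y (QuotSMulTop x M) := by
  refine (Submodule.quotEquivOfEq _ _ ?_) ≪≫ₗ
    Submodule.quotientQuotientEquivQuotientSup (y • ⊤) (x • ⊤) ≪≫ₗ
    Submodule.quotEquivOfEq _ _ (sup_comm _ _) ≪≫ₗ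
    (Submodule.quotientQuotientEquivQuotientSup (x • ⊤) (y • ⊤)).symm ≪≫ₗ
    (Submodule.quotEquivOfEq _ _ ?_)
  · rw [Submodule.map_pointwise_smul, Submodule.map_top, Submodule.range_mkQ]
  · rw [Submodule.map_pointwise_smul, Submodule.map_top, Submodule.range_mkQ]

variable [IsLocalRing R]

lemma idealDepth_eq_zero_of_smul_eq_zero {u : M} (hu : u ≠ 0)
    (h : ∀ r ∈ maximalIdeal R, r • u = 0) : idealDepth (maximalIdeal R) M = 0 := by
  refine nonpos_iff_eq_zero.mp (idealDepth_le_iff.mpr ?_)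
  rintro (_ | ⟨r, rs⟩) hI hr
  · simp
  · exact absurd (((isRegular_cons_iff M r rs).mp hr).1.right_eq_zero_of_smul
      (h r (hI r (by simp)))) hu

lemma exists_isSMulRegular_of_idealDepth_ne_zero
    (h : idealDepth (maximalIdeal R) M ≠ 0) : ∃ r ∈ maximalIdeal R, IsSMulRegular M r := by
  contrapose! h
  refine nonpos_iff_eq_zero.mp (idealDepth_le_iff.mpr ?_)
  rintro (_ | ⟨r, rs⟩) hI hr
  · simp
  · exact absurd ((isRegular_cons_iff M r rs).mp hr).1 (h r (hI r (by simp)))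

variable [IsNoetherianRing R]

/-- If the maximal ideal contains no `M`-regular element, it kills a nonzero element of `M`. -/
lemma exists_ne_zero_forall_maximalIdeal_smul_eq_zero [Module.Finite R M]
    (h : ∀ r ∈ maximalIdeal R, ¬ IsSMulRegular M r) :
    ∃ u : M, u ≠ 0 ∧ ∀ r ∈ maximalIdeal R, r • u = 0 := by
  have := (IsSMulRegular.subsingleton_linearMap_iff (R := R) (M := M)
    (N := R ⧸ maximalIdeal R)).not.mpr (by simpa [Ideal.annihilator_quotient] using h)
  rw [not_subsingleton_iff_nontrivial] at this
  obtain ⟨f, hf⟩ := exists_ne (0 : (R ⧸ maximalIdeal R) →ₗ[R] M)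
  refine ⟨f 1, fun h0 ↦ hf ?_, fun r hr ↦ ?_⟩
  · ext
    simpa using h0
  · rw [← map_smul, Algebra.smul_def, mul_one, Ideal.Quotient.algebraMap_eq,
      Ideal.Quotient.eq_zero_iff_mem.mpr hr, map_zero]

/-- Passing to the quotient by a regular element shortens the available weakly regular sequences
by at most one. -/
lemma exists_isWeaklyRegular_quotSMulTop (n : ℕ) : ∀ (M : Type*) [AddCommGroup M] [Module R M]
    [Module.Finite R M] (x : R) (_ : x ∈ maximalIdeal R) (_ : IsSMulRegular M x) (ys : List R)
    (_ : ∀ y ∈ ys, y ∈ maximalIdeal R) (_ : IsWeaklyRegular M ys) (_ : ys.length = n + 1),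
    ∃ zs : List R, (∀ z ∈ zs, z ∈ maximalIdeal R) ∧ IsWeaklyRegular (QuotSMulTop x M) zs ∧
      zs.length = n := by
  induction n with
  | zero => exact fun M _ _ _ x _ _ ys _ _ _ ↦ ⟨[], by simp, by simp, rfl⟩
  | succ n ih =>
    intro M _ _ _ x hx hxr ys hys hysr hlen
    match ys, hlen with
    | y₁ :: y₂ :: ys, hlen =>
    rw [isWeaklyRegular_cons_iff] at hysr
    have hy₁ : y₁ ∈ maximalIdeal R := hys y₁ (by simp)
    have hy₂ : y₂ ∈ maximalIdeal R := hys y₂ (by simp)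
    have hy₂r := ((isWeaklyRegular_cons_iff _ _ _).mp hysr.2).1
    obtain ⟨z, hz, hzr⟩ : ∃ z ∈ maximalIdeal R,
        IsSMulRegular (QuotSMulTop x M × QuotSMulTop y₁ M) z := by
      by_contra! hcon
      obtain ⟨u, hu, hu0⟩ := exists_ne_zero_forall_maximalIdeal_smul_eq_zero hcon
      obtain ⟨v, hv, hv0⟩ : ∃ v : QuotSMulTop y₁ M, v ≠ 0 ∧ ∀ r ∈ maximalIdeal R, r • v = 0 := by
        by_cases h2 : u.2 = 0
        · refine exists_ne_zero_smul_eq_zero_quotSMulTop hy₁ hxr hysr.1 (u := u.1)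
            (fun h1 ↦ hu (Prod.ext h1 h2)) fun r hr ↦ congrArg Prod.fst (hu0 r hr)
        · exact ⟨u.2, h2, fun r hr ↦ congrArg Prod.snd (hu0 r hr)⟩
      exact hv (hy₂r.right_eq_zero_of_smul (hv0 y₂ hy₂))
    have hzx : IsSMulRegular (QuotSMulTop x M) z := fun a b h ↦
      congrArg Prod.fst (hzr (a₁ := (a, 0)) (a₂ := (b, 0)) (by simpa using h))
    have hzy : IsSMulRegular (QuotSMulTop y₁ M) z := fun a b h ↦
      congrArg Prod.snd (hzr (a₁ := (0, a)) (a₂ := (0, b)) (by simpa using h))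
    have swap {w : R} (hw : w ∈ maximalIdeal R) (hwr : IsSMulRegular M w)
        (hzw : IsSMulRegular (QuotSMulTop w M) z) :
        IsSMulRegular M z ∧ IsSMulRegular (QuotSMulTop z M) w := by
      have h : IsWeaklyRegular M [w, z] := by
        exact .cons hwr ((isWeaklyRegular_singleton_iff _ _).mpr hzw)
      have := IsLocalRing.isWeaklyRegular_of_perm_of_subset_maximalIdeal h
        (List.Perm.swap z w []) (List.forall_mem_cons.mpr ⟨hw, by simpa using hz⟩)
      simpa [isWeaklyRegular_cons_iff] using this
    obtain ⟨zs, hzs, hzsr, hzsl⟩ := ih (QuotSMulTop y₁ M) z hz hzy (y₂ :: ys)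
      (fun y hy ↦ hys y (List.mem_cons_of_mem _ hy)) hysr.2 (by simpa using hlen)
    obtain ⟨ws, hws, hwsr, hwsl⟩ := ih (QuotSMulTop z M) x hx (swap hx hxr hzx).2 (y₁ :: zs)
      (List.forall_mem_cons.mpr ⟨hy₁, hzs⟩)
      (.cons (swap hy₁ hysr.1 hzy).2
        (((quotSMulTopComm M z y₁).isWeaklyRegular_congr zs).mp hzsr)) (by simp [hzsl])
    exact ⟨z :: ws, List.forall_mem_cons.mpr ⟨hz, hws⟩, .cons hzx
      (((quotSMulTopComm M x z).isWeaklyRegular_congr ws).mp hwsr), by simp [hwsl]⟩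

lemma idealDepth_eq_idealDepth_quotSMulTop_add_one [Module.Finite R M] [Nontrivial M] {x : R}
    (hx : x ∈ maximalIdeal R) (hxr : IsSMulRegular M x) :
    idealDepth (maximalIdeal R) M = idealDepth (maximalIdeal R) (QuotSMulTop x M) + 1 := by
  have := nontrivial_quotSMulTop_of_mem_maximalIdeal (L := M) hx
  apply le_antisymm
  · refine idealDepth_le_iff.mpr fun rs hI hr ↦ ?_
    cases hn : rs.length with
    | zero => simp
    | succ n =>
      obtain ⟨zs, hzs, hzsr, rfl⟩ := exists_isWeaklyRegular_quotSMulTop n M x hx hxr rs hI hr.1 hn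
      push_cast
      gcongr
      exact length_le_idealDepth hzs
        (.of_isWeaklyRegular_of_mem_maximalIdeal (QuotSMulTop x M) hzs hzsr)
  · obtain h | h := eq_or_ne (idealDepth (maximalIdeal R) M) ⊤
    · simp [h]
    have hle (rs : List R) (hI : ∀ r ∈ rs, r ∈ maximalIdeal R)
        (hr : IsRegular (QuotSMulTop x M) rs) :
        (rs.length : ℕ∞) + 1 ≤ idealDepth (maximalIdeal R) M := by
      simpa using length_le_idealDepth (rs := x :: rs) (List.forall_mem_cons.mpr ⟨hx, hI⟩)
        (.cons hxr hr)
    have h1 : 1 ≤ idealDepth (maximalIdeal R) M := by simpa using hle [] (by simp) (.nil R _)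
    obtain ⟨d, hd⟩ := ENat.ne_top_iff_exists.mp h
    rw [← hd] at hle h1 ⊢
    obtain ⟨d, rfl⟩ : ∃ e, d = e + 1 := ⟨d - 1, by have : 1 ≤ d := mod_cast h1; omega⟩
    push_cast
    gcongr
    refine idealDepth_le_iff.mpr fun rs hI hr ↦ ?_
    have := hle rs hI hr
    norm_cast at this ⊢
    omega

lemma idealDepth_maximalIdeal_ne_top [Module.Finite R M] :
    idealDepth (maximalIdeal R) M ≠ ⊤ := by
  refine ne_top_of_le_ne_top (Ideal.height_ne_top_of_isPrime (I := maximalIdeal R))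
    (idealDepth_le_iff.mpr fun rs hI hr ↦ ?_)
  have h := Module.supportDim_add_length_eq_supportDim_of_isRegular rs hr
  have := hr.quot_ofList_smul_nontrivial ⊤
  have h0 : Module.supportDim R (M ⧸ Ideal.ofList rs • (⊤ : Submodule R M)) ≠ ⊥ :=
    (Module.supportDim_ne_bot_iff_nontrivial R _).mpr ‹_›
  have h1 := h.le.trans (Module.supportDim_le_ringKrullDim R M)
  rw [← maximalIdeal_height_eq_ringKrullDim] at h1
  obtain ⟨d, hd⟩ := WithBot.ne_bot_iff_exists.mp h0
  rw [← hd] at h1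
  exact le_of_add_le_right (a := d) (by exact_mod_cast h1)

end Depth

section Flat

open TensorProduct

lemma IsLocalRing.isFiniteLength_quotient_pow_maximalIdeal_smul_top {A N : Type*} [CommRing A]
    [IsLocalRing A] [IsNoetherianRing A] [AddCommGroup N] [Module A N] [Module.Finite A N] (j : ℕ) :
    IsFiniteLength A (N ⧸ (maximalIdeal A ^ j • ⊤ : Submodule A N)) := by
  obtain rfl | hj := eq_or_ne j 0
  · have : Subsingleton (N ⧸ (maximalIdeal A ^ 0 • ⊤ : Submodule A N)) := by
      simp [Submodule.Quotient.subsingleton_iff]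
    exact .of_subsingleton
  have : IsArtinianRing (A ⧸ maximalIdeal A ^ j) :=
    quotient_artinian_of_mem_minimalPrimes_of_isLocalRing _
      ⟨⟨inferInstance, Ideal.pow_le_self hj⟩, fun q hq _ ↦ hq.1.le_of_pow_le hq.2⟩
  rw [isFiniteLength_iff_isNoetherian_isArtinian]
  refine ⟨inferInstance, ?_⟩
  have : Module.Finite (A ⧸ maximalIdeal A ^ j) (N ⧸ (maximalIdeal A ^ j • ⊤ : Submodule A N)) :=
    .of_restrictScalars_finite A _ _
  exact isArtinian_of_surjective_algebraMap
    (Ideal.Quotient.mk_surjective (I := maximalIdeal A ^ j))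

variable {A B M N : Type*} [CommRing A] [CommRing B] [Algebra A B]
  [AddCommGroup M] [Module A M] [Module B M] [IsScalarTower A B M] [AddCommGroup N] [Module A N]

lemma Module.Finite.tensorProduct_of_isScalarTower [Module.Finite B M] [Module.Finite A N] :
    Module.Finite B (M ⊗[A] N) :=
  .equiv (TensorProduct.AlgebraTensorModule.cancelBaseChange A B B M N)

/-- Regularity of `y` on `M ⊗ N` propagates along short exact sequences in `N` if `M` is flat. -/
lemma isSMulRegular_tensorProduct_of_submodule [Module.Flat A M] {y : B} (N' : Submodule A N)
    (h₁ : IsSMulRegular (M ⊗[A] N') y) (h₂ : IsSMulRegular (M ⊗[A] (N ⧸ N')) y) :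
    IsSMulRegular (M ⊗[A] N) y := by
  refine isSMulRegular_of_range_eq_ker
    (f := AlgebraTensorModule.lTensor B M N'.subtype) (g := AlgebraTensorModule.lTensor B M N'.mkQ)
    (Module.Flat.lTensor_preserves_injective_linearMap _ N'.injective_subtype) ?_ h₁ h₂
  have := lTensor_exact M (LinearMap.exact_subtype_mkQ N') N'.mkQ_surjective
  ext x
  exact (this x).symm

variable [IsLocalRing A]

lemma isSMulRegular_tensorProduct_of_isFiniteLength [Module.Flat A M] {y : B}
    (hy : IsSMulRegular (M ⊗[A] (A ⧸ maximalIdeal A)) y) (hN : IsFiniteLength A N) :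
    IsSMulRegular (M ⊗[A] N) y := by
  induction hN with
  | of_subsingleton => exact fun _ _ _ ↦ Subsingleton.elim _ _
  | @of_simple_quotient N _ _ N' hs _ ih =>
    refine isSMulRegular_tensorProduct_of_submodule N' ih ?_
    obtain ⟨I, hI, ⟨e⟩⟩ := isSimpleModule_iff_quot_maximal.mp hs
    obtain rfl := eq_maximalIdeal hI
    exact ((AlgebraTensorModule.congr (.refl B M) e).isSMulRegular_congr y).mpr hy

variable [IsNoetherianRing A] [IsNoetherianRing B] [IsLocalRing B] [IsLocalHom (algebraMap A B)]
  [Module.Finite B M] [Module.Finite A N]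

/-- If `M` is flat over `A`, an element regular on the closed fiber of `M` is regular on all base
changes of `M` to finite `A`-modules. -/
lemma isSMulRegular_tensorProduct_of_isSMulRegular_fiber [Module.Flat A M] {y : B}
    (hy : IsSMulRegular (M ⊗[A] (A ⧸ maximalIdeal A)) y) : IsSMulRegular (M ⊗[A] N) y := by
  have : Module.Finite B (M ⊗[A] N) := .tensorProduct_of_isScalarTower
  have hpow (j : ℕ) : (maximalIdeal A ^ j).map (algebraMap A B) ≤ maximalIdeal B ^ j := by
    rw [Ideal.map_pow]
    exact Ideal.pow_right_mono (((local_hom_TFAE (algebraMap A B)).out 0 2).mp ‹_›) j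
  rw [isSMulRegular_iff_right_eq_zero_of_smul]
  intro u hu
  rw [← Submodule.mem_bot B, ← Ideal.iInf_pow_smul_eq_bot_of_isLocalRing (maximalIdeal B)
    Ideal.IsPrime.ne_top', Submodule.mem_iInf]
  intro j
  let N' : Submodule A N := maximalIdeal A ^ j • ⊤
  have hreg := isSMulRegular_tensorProduct_of_isFiniteLength hy
    (isFiniteLength_quotient_pow_maximalIdeal_smul_top (N := N) j)
  have hu0 : AlgebraTensorModule.lTensor B M N'.mkQ u = 0 :=
    hreg.right_eq_zero_of_smul (by rw [← map_smul, hu, map_zero])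
  obtain ⟨v, rfl⟩ := (lTensor_exact M (LinearMap.exact_subtype_mkQ N') N'.mkQ_surjective u).mp hu0
  clear hu hu0
  induction v with
  | zero => simp
  | add v w hv hw => rw [map_add]; exact add_mem hv hw
  | tmul m n =>
    obtain ⟨n, hn⟩ := n
    rw [LinearMap.lTensor_tmul, Submodule.subtype_apply]
    change m ⊗ₜ n ∈ _
    refine Submodule.smul_induction_on hn (fun r hr n _ ↦ ?_) fun n n' hn hn' ↦ ?_
    · rw [← smul_tmul, ← algebraMap_smul B r m, ← smul_tmul']
      exact Submodule.smul_mem_smul (hpow j (Ideal.mem_map_of_mem _ hr)) trivial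
    · rw [tmul_add]
      exact add_mem hn hn'

end Flat

section DepthFlat

open TensorProduct
open scoped Pointwise

lemma exists_ne_zero_forall_smul_eq_zero_of_idealDepth_eq_zero {R M : Type*} [CommRing R]
    [IsNoetherianRing R] [IsLocalRing R] [AddCommGroup M] [Module R M] [Module.Finite R M]
    [Nontrivial M] (h : idealDepth (maximalIdeal R) M = 0) :
    ∃ u : M, u ≠ 0 ∧ ∀ r ∈ maximalIdeal R, r • u = 0 := by
  refine exists_ne_zero_forall_maximalIdeal_smul_eq_zero fun r hr hreg ↦ ?_
  simp [idealDepth_eq_idealDepth_quotSMulTop_add_one hr hreg] at h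

/-- A surjection whose kernel is generated by a regular element `x` of the maximal ideal
lowers the depth by exactly one. -/
lemma idealDepth_eq_add_one_of_surjective {R M M' : Type*} [CommRing R] [IsNoetherianRing R]
    [IsLocalRing R] [AddCommGroup M] [Module R M] [Module.Finite R M] [Nontrivial M]
    [AddCommGroup M'] [Module R M'] {x : R} (hx : x ∈ maximalIdeal R) (hxr : IsSMulRegular M x)
    {f : M →ₗ[R] M'} (hf : Function.Surjective f) (hker : ∀ m, f m = 0 → ∃ m', x • m' = m)
    (h0 : ∀ m, x • f m = 0) :
    Nontrivial M' ∧ idealDepth (maximalIdeal R) M = idealDepth (maximalIdeal R) M' + 1 := by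
  have hk : x • (⊤ : Submodule R M) = LinearMap.ker f := by
    ext m
    simp only [Submodule.mem_smul_pointwise_iff_exists, Submodule.mem_top, true_and,
      LinearMap.mem_ker]
    refine ⟨?_, hker m⟩
    rintro ⟨m', rfl⟩
    rw [map_smul, h0]
  let e : QuotSMulTop x M ≃ₗ[R] M' :=
    Submodule.quotEquivOfEq _ _ hk ≪≫ₗ f.quotKerEquivOfSurjective hf
  have := nontrivial_quotSMulTop_of_mem_maximalIdeal (L := M) hx
  exact ⟨e.symm.nontrivial, by
    rw [idealDepth_eq_idealDepth_quotSMulTop_add_one hx hxr, e.idealDepth_eq]⟩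

section

variable {A B M N : Type*} [CommRing A] [CommRing B] [Algebra A B]
  [AddCommGroup M] [Module A M] [Module B M] [IsScalarTower A B M] [AddCommGroup N] [Module A N]

lemma rTensor_mkQ_quotSMulTop_smul (y : B) (u : M ⊗[A] N) :
    y • AlgebraTensorModule.rTensor A N (y • (⊤ : Submodule B M)).mkQ u = 0 := by
  rw [← map_smul]
  induction u with
  | zero => simp
  | add v w hv hw => rw [smul_add, map_add, hv, hw, add_zero]
  | tmul m n =>
    rw [smul_tmul', AlgebraTensorModule.rTensor_tmul, Submodule.mkQ_apply,
      (Submodule.Quotient.mk_eq_zero _).mpr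
        (Submodule.smul_mem_pointwise_smul _ _ _ Submodule.mem_top),
      zero_tmul]

lemma exists_smul_eq_of_rTensor_mkQ_eq_zero {y : B} {u : M ⊗[A] N}
    (hu : AlgebraTensorModule.rTensor A N (y • (⊤ : Submodule B M)).mkQ u = 0) :
    ∃ v, y • v = u := by
  let f : M →ₗ[A] M := (LinearMap.lsmul B M y).restrictScalars A
  let g : M →ₗ[A] QuotSMulTop y M := (y • (⊤ : Submodule B M)).mkQ.restrictScalars A
  have hex : Function.Exact f g := fun m ↦
    (Submodule.Quotient.mk_eq_zero _).trans ((Submodule.mem_smul_pointwise_iff_exists _ _ _).trans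
      ⟨fun ⟨m', _, h⟩ ↦ ⟨m', h⟩, fun ⟨m', h⟩ ↦ ⟨m', trivial, h⟩⟩)
  have hg : Function.Surjective g := (y • (⊤ : Submodule B M)).mkQ_surjective
  have hex' := rTensor_exact N hex hg
  obtain ⟨v, rfl⟩ := (hex' u).mp hu
  refine ⟨v, ?_⟩
  clear hu
  induction v with
  | zero => simp
  | add v w hv hw => rw [smul_add, map_add, hv, hw]
  | tmul m n => rfl

lemma rTensor_mkQ_quotSMulTop_surjective (y : B) : Function.Surjective
    (AlgebraTensorModule.rTensor A N (y • (⊤ : Submodule B M)).mkQ) :=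
  LinearMap.rTensor_surjective N
    (g := (y • (⊤ : Submodule B M)).mkQ.restrictScalars A) (y • (⊤ : Submodule B M)).mkQ_surjective

lemma exists_algebraMap_smul_eq_of_lTensor_mkQ_eq_zero {x : A} {u : M ⊗[A] N}
    (hu : AlgebraTensorModule.lTensor B M (x • (⊤ : Submodule A N)).mkQ u = 0) :
    ∃ v, algebraMap A B x • v = u := by
  have hex : Function.Exact (LinearMap.lsmul A N x) (x • (⊤ : Submodule A N)).mkQ := fun m ↦ by
    simp [Submodule.mem_smul_pointwise_iff_exists]
  obtain ⟨v, rfl⟩ := (lTensor_exact M hex (Submodule.mkQ_surjective _) u).mp hu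
  refine ⟨v, ?_⟩
  clear hu
  induction v with
  | zero => simp
  | add v w hv hw => rw [smul_add, map_add, hv, hw]
  | tmul m n => simp

lemma algebraMap_smul_lTensor_mkQ (x : A) (u : M ⊗[A] N) :
    algebraMap A B x • AlgebraTensorModule.lTensor B M (x • (⊤ : Submodule A N)).mkQ u = 0 := by
  rw [← map_smul]
  induction u with
  | zero => simp
  | add v w hv hw => rw [smul_add, map_add, hv, hw, add_zero]
  | tmul m n =>
    rw [algebraMap_smul, smul_tmul', smul_tmul, AlgebraTensorModule.lTensor_tmul,
      Submodule.mkQ_apply, (Submodule.Quotient.mk_eq_zero _).mpr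
        (Submodule.smul_mem_pointwise_smul _ _ _ Submodule.mem_top),
      tmul_zero]

/-- If `M` is flat and `y` is regular on `M ⊗ (A / I)` for all ideals `I`, then `M / yM` is
flat. -/
lemma Module.Flat.quotSMulTop [Module.Flat A M] {y : B}
    (h : ∀ I : Ideal A, IsSMulRegular (M ⊗[A] (A ⧸ I)) y) : Module.Flat A (QuotSMulTop y M) := by
  refine Module.Flat.iff_lTensor_injective.mpr fun I _ ↦
    (injective_iff_map_eq_zero _).mpr fun b' hb' ↦ ?_
  obtain ⟨b, rfl⟩ := rTensor_mkQ_quotSMulTop_surjective (A := A) (M := M) (N := I) y b'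
  have hι : Function.Injective (AlgebraTensorModule.lTensor B M I.subtype) :=
    Module.Flat.lTensor_preserves_injective_linearMap _ I.injective_subtype
  have hcomm : AlgebraTensorModule.rTensor A A (y • (⊤ : Submodule B M)).mkQ
      (AlgebraTensorModule.lTensor B M I.subtype b) = 0 := by
    rw [← hb']
    clear hb'
    induction b with
    | zero => simp
    | add v w hv hw => simp only [map_add, hv, hw]
    | tmul m n => rfl
  obtain ⟨c, hc⟩ := exists_smul_eq_of_rTensor_mkQ_eq_zero hcomm
  have hex : Function.Exact (AlgebraTensorModule.lTensor B M I.subtype)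
      (AlgebraTensorModule.lTensor B M I.mkQ) := by
    have := _root_.lTensor_exact M (LinearMap.exact_subtype_mkQ I) I.mkQ_surjective
    exact fun u ↦ this u
  have hc0 : AlgebraTensorModule.lTensor B M I.mkQ c = 0 :=
    (h I).right_eq_zero_of_smul (by rw [← map_smul, hc, hex.apply_apply_eq_zero])
  obtain ⟨c', rfl⟩ := (hex c).mp hc0
  rw [← map_smul] at hc
  rw [← hι hc, map_smul, rTensor_mkQ_quotSMulTop_smul]

variable [IsNoetherianRing A] [IsNoetherianRing B] [IsLocalRing A] [IsLocalRing B]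

lemma idealDepth_tensorProduct_of_eq_zero [Module.Flat A M] [Module.Finite B M] [Module.Finite A N]
    [Nontrivial (M ⊗[A] (A ⧸ maximalIdeal A))] [Nontrivial N]
    (hf : idealDepth (maximalIdeal B) (M ⊗[A] (A ⧸ maximalIdeal A)) = 0)
    (ha : idealDepth (maximalIdeal A) N = 0) :
    Nontrivial (M ⊗[A] N) ∧ idealDepth (maximalIdeal B) (M ⊗[A] N) = 0 := by
  have : Module.Finite B (M ⊗[A] (A ⧸ maximalIdeal A)) := .tensorProduct_of_isScalarTower
  obtain ⟨u, hu, hu0⟩ := exists_ne_zero_forall_smul_eq_zero_of_idealDepth_eq_zero ha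
  obtain ⟨v, hv, hv0⟩ := exists_ne_zero_forall_smul_eq_zero_of_idealDepth_eq_zero hf
  have hker : LinearMap.ker (LinearMap.toSpanSingleton A N u) = maximalIdeal A := by
    refine ((maximalIdeal.isMaximal A).eq_of_le (fun h ↦ hu ?_) fun r hr ↦ ?_).symm
    · simpa using (Ideal.eq_top_iff_one _).mp h
    · simpa using hu0 r hr
  let i : (A ⧸ maximalIdeal A) →ₗ[A] N :=
    (maximalIdeal A).liftQ (LinearMap.toSpanSingleton A N u) hker.ge
  have hi : Function.Injective i :=
    LinearMap.ker_eq_bot.mp (Submodule.ker_liftQ_eq_bot _ _ _ hker.le)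
  have hi' : Function.Injective (AlgebraTensorModule.lTensor B M i) :=
    Module.Flat.lTensor_preserves_injective_linearMap _ hi
  have hne : AlgebraTensorModule.lTensor B M i v ≠ 0 := fun h ↦ hv (hi' (by rw [h, map_zero]))
  exact ⟨nontrivial_of_ne _ _ hne, idealDepth_eq_zero_of_smul_eq_zero hne fun r hr ↦ by
    rw [← map_smul, hv0 r hr, map_zero]⟩

lemma idealDepth_tensorProduct_eq_idealDepth_quotSMulTop_add_one [IsLocalHom (algebraMap A B)]
    [Module.Flat A M] [Module.Finite B M] [Module.Finite A N] [Nontrivial (M ⊗[A] N)] {y : B}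
    (hy : y ∈ maximalIdeal B) (hyr : IsSMulRegular (M ⊗[A] (A ⧸ maximalIdeal A)) y) :
    Nontrivial (QuotSMulTop y M ⊗[A] N) ∧ idealDepth (maximalIdeal B) (M ⊗[A] N) =
      idealDepth (maximalIdeal B) (QuotSMulTop y M ⊗[A] N) + 1 :=
  have : Module.Finite B (M ⊗[A] N) := .tensorProduct_of_isScalarTower
  idealDepth_eq_add_one_of_surjective hy (isSMulRegular_tensorProduct_of_isSMulRegular_fiber hyr)
    (rTensor_mkQ_quotSMulTop_surjective y)
    (fun _ ↦ exists_smul_eq_of_rTensor_mkQ_eq_zero) (rTensor_mkQ_quotSMulTop_smul y)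

end

/-- The depth of `M ⊗ N` is the sum of the depth of `N` and that of the closed fiber of `M`, for
`M` flat over the base. -/
lemma idealDepth_tensorProduct_eq_add {A B : Type*} [CommRing A] [CommRing B] [Algebra A B]
    [IsNoetherianRing A] [IsNoetherianRing B] [IsLocalRing A] [IsLocalRing B]
    [IsLocalHom (algebraMap A B)] (f a : ℕ) :
    ∀ (M N : Type*) [AddCommGroup M] [Module A M] [Module B M] [IsScalarTower A B M]
      [AddCommGroup N] [Module A N] [Module.Flat A M] [Module.Finite B M] [Module.Finite A N]
      [Nontrivial (M ⊗[A] (A ⧸ maximalIdeal A))] [Nontrivial N]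
      (_ : idealDepth (maximalIdeal B) (M ⊗[A] (A ⧸ maximalIdeal A)) = f)
      (_ : idealDepth (maximalIdeal A) N = a),
      Nontrivial (M ⊗[A] N) ∧ idealDepth (maximalIdeal B) (M ⊗[A] N) = a + f := by
  induction f with
  | zero =>
    induction a with
    | zero =>
      intro M N _ _ _ _ _ _ _ _ _ _ _ hf ha
      simpa using idealDepth_tensorProduct_of_eq_zero hf ha
    | succ a ih =>
      intro M N _ _ _ _ _ _ _ _ _ _ _ hf ha
      obtain ⟨x, hx, hxr⟩ := exists_isSMulRegular_of_idealDepth_ne_zero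
        (R := A) (M := N) (by simp [ha])
      have hN' := nontrivial_quotSMulTop_of_mem_maximalIdeal (L := N) hx
      have ha' := idealDepth_eq_idealDepth_quotSMulTop_add_one hx hxr
      rw [ha, Nat.cast_add, Nat.cast_one] at ha'
      replace ha' := ENat.add_left_injective_of_ne_top ENat.one_ne_top ha'
      obtain ⟨hnt, hd⟩ := ih M (QuotSMulTop x N) hf ha'.symm
      have hsurj : Function.Surjective
          (AlgebraTensorModule.lTensor B M (x • (⊤ : Submodule A N)).mkQ) :=
        LinearMap.lTensor_surjective M (Submodule.mkQ_surjective _)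
      have : Module.Finite B (M ⊗[A] N) := .tensorProduct_of_isScalarTower
      have := hsurj.nontrivial
      refine ⟨this, ?_⟩
      have hreg : IsSMulRegular (M ⊗[A] N) (algebraMap A B x) := fun u v h ↦
        hxr.lTensor M (by simpa using h)
      have := (idealDepth_eq_add_one_of_surjective
        ((map_mem_nonunits_iff (algebraMap A B) x).mpr hx) hreg hsurj
        (fun _ ↦ exists_algebraMap_smul_eq_of_lTensor_mkQ_eq_zero)
        (algebraMap_smul_lTensor_mkQ x)).2
      rw [this, hd]
      push_cast
      ring
  | succ f ih =>
    intro M N _ _ _ _ _ _ _ _ _ _ _ hf ha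
    obtain ⟨y, hy, hyr⟩ := exists_isSMulRegular_of_idealDepth_ne_zero
      (R := B) (M := M ⊗[A] (A ⧸ maximalIdeal A)) (by simp [hf])
    have := Module.Flat.quotSMulTop fun I ↦
      isSMulRegular_tensorProduct_of_isSMulRegular_fiber (N := A ⧸ I) hyr
    obtain ⟨hk, hf'⟩ := idealDepth_tensorProduct_eq_idealDepth_quotSMulTop_add_one
      (N := A ⧸ maximalIdeal A) hy hyr
    rw [hf, Nat.cast_add, Nat.cast_one] at hf'
    replace hf' := ENat.add_left_injective_of_ne_top ENat.one_ne_top hf'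
    obtain ⟨hnt, hd⟩ := ih (QuotSMulTop y M) N hf'.symm ha
    have := (rTensor_mkQ_quotSMulTop_surjective (A := A) (M := M) (N := N) y).nontrivial
    refine ⟨this, ?_⟩
    rw [(idealDepth_tensorProduct_eq_idealDepth_quotSMulTop_add_one (N := N) hy hyr).2, hd]
    push_cast
    ring

end DepthFlat

section LocalFlat

open TensorProduct

variable {A B : Type*} [CommRing A] [CommRing B] [Algebra A B] [IsNoetherianRing A]
  [IsNoetherianRing B] [IsLocalRing A] [IsLocalRing B] [IsLocalHom (algebraMap A B)]
  [Module.Flat A B]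

lemma ringDepth_eq_ringDepth_add_of_flat
    [IsLocalRing (B ⧸ (maximalIdeal A).map (algebraMap A B))] :
    ringDepth B = ringDepth A + ringDepth (B ⧸ (maximalIdeal A).map (algebraMap A B)) := by
  let e := (Algebra.TensorProduct.quotIdealMapEquivTensorQuot B (maximalIdeal A)).symm.toLinearEquiv
  have hloc : IsLocalHom (algebraMap B (B ⧸ (maximalIdeal A).map (algebraMap A B))) :=
    .of_surjective _ Ideal.Quotient.mk_surjective
  have hcomap : (maximalIdeal (B ⧸ (maximalIdeal A).map (algebraMap A B))).comap
      (algebraMap B (B ⧸ (maximalIdeal A).map (algebraMap A B))) = maximalIdeal B :=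
    ((local_hom_TFAE (algebraMap B (B ⧸ (maximalIdeal A).map (algebraMap A B)))).out 0 4).mp hloc
  have hfib : idealDepth (maximalIdeal B) (B ⊗[A] (A ⧸ maximalIdeal A)) =
      ringDepth (B ⧸ (maximalIdeal A).map (algebraMap A B)) := by
    rw [e.idealDepth_eq, ringDepth,
      ← idealDepth_comap_of_surjective (R := B) Ideal.Quotient.mk_surjective,
      hcomap]
  have : Nontrivial (B ⊗[A] (A ⧸ maximalIdeal A)) := e.nontrivial
  obtain ⟨f, hf⟩ := ENat.ne_top_iff_exists.mp
    (idealDepth_maximalIdeal_ne_top (R := B ⧸ (maximalIdeal A).map (algebraMap A B))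
      (M := B ⧸ (maximalIdeal A).map (algebraMap A B)))
  obtain ⟨a, ha⟩ := ENat.ne_top_iff_exists.mp (idealDepth_maximalIdeal_ne_top (R := A) (M := A))
  rw [ringDepth, ← (AlgebraTensorModule.rid A B B).idealDepth_eq,
    (idealDepth_tensorProduct_eq_add f a B A (hfib.trans hf.symm) ha.symm).2, ringDepth, ringDepth,
    ← hf, ← ha]

lemma height_maximalIdeal_eq_height_add_of_flat
    [IsLocalRing (B ⧸ (maximalIdeal A).map (algebraMap A B))] :
    (maximalIdeal B).height = (maximalIdeal A).height +
      (maximalIdeal (B ⧸ (maximalIdeal A).map (algebraMap A B))).height := by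
  have hcomap : (maximalIdeal B).comap (algebraMap A B) = maximalIdeal A :=
    ((local_hom_TFAE (algebraMap A B)).out 0 4).mp ‹_›
  have : (maximalIdeal B).LiesOver (maximalIdeal A) := ⟨hcomap.symm⟩
  rw [Ideal.height_eq_height_add_of_liesOver_of_hasGoingDown (maximalIdeal A) (maximalIdeal B),
    map_maximalIdeal_of_surjective _ Ideal.Quotient.mk_surjective]

/-- A flat local extension with Cohen-Macaulay closed fiber is almost Cohen-Macaulay if and only
if the base is. -/
lemma isAlmostCM_iff_of_flat {F : Type*} [CommRing F] [IsLocalRing F]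
    (e : F ≃+* B ⧸ (maximalIdeal A).map (algebraMap A B))
    (hF : ringKrullDim F = ((ringDepth F : ℕ∞) : WithBot ℕ∞)) :
    IsAlmostCM B ↔ IsAlmostCM A := by
  have := e.isLocalRing
  rw [ringKrullDim_eq_of_ringEquiv e, e.ringDepth_eq, ← maximalIdeal_height_eq_ringKrullDim,
    WithBot.coe_inj] at hF
  rw [IsAlmostCM, IsAlmostCM, ← maximalIdeal_height_eq_ringKrullDim,
    ← maximalIdeal_height_eq_ringKrullDim, WithBot.coe_le_coe, WithBot.coe_le_coe,
    height_maximalIdeal_eq_height_add_of_flat (A := A), ringDepth_eq_ringDepth_add_of_flat (A := A),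
    hF, ← add_assoc]
  exact ENat.add_le_add_iff_right idealDepth_maximalIdeal_ne_top

end LocalFlat

lemma isAlmostCM_localization_iff_of_flat {A B : Type*} [CommRing A] [CommRing B] [Algebra A B]
    [IsNoetherianRing A] [IsNoetherianRing B] [Module.Flat A B] (P : Ideal A) [P.IsPrime]
    (hP : IsCMring (P.Fiber B)) (Q : Ideal B) [Q.IsPrime] [Q.LiesOver P] :
    IsAlmostCM (Localization.AtPrime Q) ↔ IsAlmostCM (Localization.AtPrime P) := by
  obtain ⟨q, hq, rfl⟩ : ∃ (q : Ideal (P.Fiber B)) (_ : q.IsPrime),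
      q.comap Algebra.TensorProduct.includeRight = Q := by
    let Q' : PrimeSpectrum.comap (algebraMap A B) ⁻¹' {⟨P, ‹_›⟩} :=
      ⟨⟨Q, ‹_›⟩, PrimeSpectrum.ext (Ideal.over_def Q P).symm⟩
    let q := PrimeSpectrum.preimageEquivFiber A B ⟨P, ‹_›⟩ Q'
    refine ⟨q.asIdeal, q.isPrime, ?_⟩
    have := (PrimeSpectrum.preimageEquivFiber A B ⟨P, ‹_›⟩).symm_apply_apply Q'
    exact congrArg (fun x ↦ x.1.asIdeal) this
  let Q := q.comap Algebra.TensorProduct.includeRight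
  let := Localization.AtPrime.algebraOfLiesOver P Q
  refine isAlmostCM_iff_of_flat (F := Localization.AtPrime q)
    ((Ideal.Fiber.localizationAlgEquivQuotient P q).toRingEquiv.trans
      (Ideal.quotEquivOfEq ?_)) (hP q)
  rw [← Localization.AtPrime.map_eq_maximalIdeal, Ideal.map_map, ← IsScalarTower.algebraMap_eq]

theorem almostCM_iff_of_faithfully_flat_CM_fibers {A B : Type*} [CommRing A] [CommRing B]
    [IsNoetherianRing A] [IsNoetherianRing B] [Algebra A B] [Module.FaithfullyFlat A B]
    (hfib : ∀ (P : Ideal A) [P.IsPrime],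
      IsCMring (TensorProduct A (ResidueField (Localization.AtPrime P)) B)) :
    IsACMring B ↔ IsACMring A := by
  have key (P : Ideal A) [P.IsPrime] (Q : Ideal B) [Q.IsPrime] [Q.LiesOver P] :=
    isAlmostCM_localization_iff_of_flat P (hfib P) Q
  refine ⟨fun h P hP ↦ ?_, fun h Q hQ ↦ (key (Q.under A) Q).mpr (h _)⟩
  obtain ⟨Q, hQ⟩ := PrimeSpectrum.comap_surjective_of_faithfullyFlat (B := B) ⟨P, hP⟩
  have : Q.asIdeal.LiesOver P := ⟨congrArg PrimeSpectrum.asIdeal hQ.symm⟩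
  exact (key P Q.asIdeal).mp (h _)
end
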